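/- arXiv:math-ph/0307055 — 5 statements merged into one kernel-verified Lean document; each statement's English description precedes it below -/
import Mathlib

section
/- Let a_1 < a_2 < … < a_n be real numbers and set m_{jk} = ∫_ℝ x^k e^{−(V(x) − a_j x)} dx for 1 ≤ j ≤ n and 0 ≤ k ≤ n−1. Then the determinant of the n×n matrix (m_{jk})_{1 ≤ j ≤ n, 0 ≤ k ≤ n−1} is nonzero. -/
open MeasureTheory

open Polynomial in
/-- Differentiation under the integral sign for exponential moments. -/
theorem hasDerivAt_integral_eval_mul_exp {W : ℝ → ℝ}
    (hW : ∀ (a : ℝ) (p : ℝ[X]), Integrable fun x => p.eval x * (W x * Real.exp (a * x)))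
    (p : ℝ[X]) (a : ℝ) :
    HasDerivAt (fun t => ∫ x, p.eval x * (W x * Real.exp (t * x)))
      (∫ x, (X * p).eval x * (W x * Real.exp (a * x))) a := by
  refine (hasDerivAt_integral_of_dominated_loc_of_deriv_le (μ := volume)
    (F := fun t x => p.eval x * (W x * Real.exp (t * x)))
    (F' := fun t x => (X * p).eval x * (W x * Real.exp (t * x)))
    (bound := fun x => |(X * p).eval x * (W x * Real.exp ((a + 1) * x))| +
      |(X * p).eval x * (W x * Real.exp ((a - 1) * x))|)
    (Metric.ball_mem_nhds a one_pos) (.of_forall fun t => (hW t p).aestronglyMeasurable)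
    (hW a p) (hW a (X * p)).aestronglyMeasurable (.of_forall fun x t ht => ?_)
    ((hW (a + 1) (X * p)).abs.add (hW (a - 1) (X * p)).abs) (.of_forall fun x t _ => ?_)).2
  · rw [Metric.mem_ball, Real.dist_eq, abs_lt] at ht
    have hexp : Real.exp (t * x) ≤ Real.exp ((a + 1) * x) + Real.exp ((a - 1) * x) := by
      rcases le_total 0 x with hx | hx
      · have : Real.exp (t * x) ≤ Real.exp ((a + 1) * x) := Real.exp_le_exp.2 (by nlinarith)
        linarith [Real.exp_pos ((a - 1) * x)]
      · have : Real.exp (t * x) ≤ Real.exp ((a - 1) * x) := Real.exp_le_exp.2 (by nlinarith)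
        linarith [Real.exp_pos ((a + 1) * x)]
    simp only [Real.norm_eq_abs, abs_mul, Real.abs_exp]
    rw [← mul_add, ← mul_add]
    gcongr
  · have h := ((((hasDerivAt_id t).mul_const x).exp).const_mul (W x)).const_mul (p.eval x)
    refine h.congr_deriv ?_
    simp only [eval_mul, eval_X, id_eq]
    ring

open Polynomial in
/-- The exponential moment function of a polynomial with real roots `s` against an almost
everywhere positive weight has at most `s.card` real zeros. -/
theorem card_zeros_integral_prod_mul_exp_le (s : Multiset ℝ) {W : ℝ → ℝ}
    (hpos : ∀ᵐ x, 0 < W x)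
    (hW : ∀ (a : ℝ) (p : ℝ[X]), Integrable fun x => p.eval x * (W x * Real.exp (a * x)))
    {n : ℕ} {a : Fin n → ℝ} (ha : StrictMono a)
    (hz : ∀ j, ∫ x, (s.map fun r => X - C r).prod.eval x * (W x * Real.exp (a j * x)) = 0) :
    n ≤ s.card := by
  induction s using Multiset.induction_on generalizing W n with
  | empty =>
    by_contra! hn
    have h0 := hz ⟨0, by simpa using hn⟩
    rw [integral_eq_zero_iff_of_nonneg_ae _ (hW _ _)] at h0
    · obtain ⟨x, hx, hx'⟩ := (h0.and hpos).exists
      simp [hx'.ne'] at hx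
    · filter_upwards [hpos] with x hx
      simpa using by positivity
  | cons r s ih =>
    obtain _ | n := n
    · exact Nat.zero_le _
    set p : ℝ[X] := ((r ::ₘ s).map fun r => X - C r).prod with hp
    have hderiv (t : ℝ) : HasDerivAt
        (fun t => Real.exp (-r * t) * ∫ x, p.eval x * (W x * Real.exp (t * x)))
        (Real.exp (-r * t) *
          ∫ x, ((X - C r) * p).eval x * (W x * Real.exp (t * x))) t := by
      have h := (((hasDerivAt_id t).const_mul (-r)).exp).mul
        (hasDerivAt_integral_eval_mul_exp hW p t)
      refine h.congr_deriv ?_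
      have : ∫ x, ((X - C r) * p).eval x * (W x * Real.exp (t * x)) =
          (∫ x, (X * p).eval x * (W x * Real.exp (t * x))) -
            r * ∫ x, p.eval x * (W x * Real.exp (t * x)) := by
        rw [← integral_const_mul, ← integral_sub (hW _ _) ((hW _ _).const_mul r)]
        congr with x
        simp only [eval_mul, eval_sub, eval_X, eval_C]
        ring
      rw [this]
      simp only [id_eq]
      ring
    have hrolle (j : Fin n) : ∃ b ∈ Set.Ioo (a j.castSucc) (a j.succ),
        ∫ x, ((X - C r) * p).eval x * (W x * Real.exp (b * x)) = 0 := by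
      obtain ⟨b, hb, hb'⟩ := exists_hasDerivAt_eq_zero (ha j.castSucc_lt_succ)
        (fun t _ => (hderiv t).continuousAt.continuousWithinAt)
        (by simp only [hz]; simp) (fun t _ => hderiv t)
      exact ⟨b, hb, (mul_eq_zero.1 hb').resolve_left (Real.exp_ne_zero _)⟩
    choose b hb hb' using hrolle
    rw [Multiset.card_cons]
    refine Nat.succ_le_succ (ih (W := fun x => (x - r) ^ 2 * W x) (a := b) ?_ ?_ ?_ ?_)
    · filter_upwards [hpos, volume.ae_ne r] with x hx hxr
      have := sub_ne_zero.2 hxr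
      positivity
    · intro t q
      convert hW t ((X - C r) ^ 2 * q) using 2 with x
      simp only [eval_mul, eval_pow, eval_sub, eval_X, eval_C]
      ring
    · intro i j hij
      exact (hb i).2.trans ((ha.monotone (Fin.succ_le_castSucc_iff.2 hij)).trans_lt (hb j).1)
    · intro j
      rw [← hb' j]
      congr with x
      simp only [hp, Multiset.map_cons, Multiset.prod_cons, eval_mul, eval_sub, eval_X, eval_C]
      ring

open Polynomial in
/-- The exponential moment function of a nonzero real polynomial against a positive weight has
at most as many real zeros as the degree of the polynomial. -/
theorem card_zeros_integral_eval_mul_exp_le {W : ℝ → ℝ} (hpos : ∀ x, 0 < W x)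
    (hW : ∀ (a : ℝ) (p : ℝ[X]), Integrable fun x => p.eval x * (W x * Real.exp (a * x)))
    {p : ℝ[X]} (hp : p ≠ 0) {n : ℕ} {a : Fin n → ℝ} (ha : StrictMono a)
    (hz : ∀ j, ∫ x, p.eval x * (W x * Real.exp (a j * x)) = 0) :
    n ≤ p.natDegree := by
  obtain ⟨q, hq, -, hroots⟩ := p.exists_prod_multiset_X_sub_C_mul
  have hq0 : q ≠ 0 := by rintro rfl; exact hp (by rw [← hq, mul_zero])
  have hne (x : ℝ) : q.eval x ≠ 0 := fun hx => by
    have : x ∈ q.roots := (mem_roots hq0).2 hx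
    simp [hroots] at this
  obtain ⟨c, hc⟩ : ∃ c : ℝ, ∀ x, 0 < c * q.eval x := by
    refine ⟨q.eval 0, fun x => ?_⟩
    by_contra! hx
    have hmem : (0 : ℝ) ∈ Set.range fun y => q.eval 0 * q.eval y :=
      mem_range_of_exists_le_of_exists_ge (by fun_prop) ⟨x, hx⟩ ⟨0, mul_self_nonneg _⟩
    obtain ⟨y, hy⟩ := hmem
    exact mul_ne_zero (hne 0) (hne y) hy
  refine (card_zeros_integral_prod_mul_exp_le p.roots (W := fun x => c * q.eval x * W x)
    (.of_forall fun x => mul_pos (hc x) (hpos x)) (fun t f => ?_) ha fun j => ?_).trans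
    p.card_roots'
  · convert hW t (C c * q * f) using 2 with x
    simp only [eval_mul, eval_C]
    ring
  · rw [← mul_zero c, ← hz j, ← integral_const_mul]
    congr with x
    conv_rhs => rw [← hq, eval_mul]
    ring

theorem statement_4 (V : ℝ → ℝ) (hV : Continuous V)
    (hVint : ∀ (a : ℝ) (k : ℕ),
      Integrable (fun x : ℝ => |x| ^ k * Real.exp (-(V x - a * x))))
    (n : ℕ) (a : Fin n → ℝ) (ha : StrictMono a) :
    Matrix.det (Matrix.of (fun (j : Fin n) (k : Fin n) =>
      ∫ x : ℝ, x ^ (k : ℕ) * Real.exp (-(V x - a j * x)))) ≠ 0 := by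
  have hexp (t x : ℝ) : Real.exp (-V x) * Real.exp (t * x) = Real.exp (-(V x - t * x)) := by
    rw [← Real.exp_add]
    ring_nf
  have hpow (t : ℝ) (k : ℕ) : Integrable fun x : ℝ => x ^ k * Real.exp (-(V x - t * x)) := by
    refine (hVint t k).mono (by fun_prop) (.of_forall fun x => ?_)
    simp
  have hW (t : ℝ) (p : Polynomial ℝ) :
      Integrable fun x => p.eval x * (Real.exp (-V x) * Real.exp (t * x)) := by
    simp only [hexp, Polynomial.eval_eq_sum_range, Finset.sum_mul, mul_assoc]
    exact integrable_finsetSum _ fun k _ => (hpow t k).const_mul _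
  intro hdet
  obtain ⟨v, hv, hMv⟩ := Matrix.exists_mulVec_eq_zero_iff.2 hdet
  set p : Polynomial ℝ := ∑ k : Fin n, Polynomial.monomial (k : ℕ) (v k) with hp
  have hcoeff (k : Fin n) : p.coeff k = v k := by
    simp [hp, Polynomial.finsetSum_coeff, Polynomial.coeff_monomial, Fin.val_inj]
  have hp0 : p ≠ 0 := by
    intro h
    exact hv (funext fun k => by simp [← hcoeff, h])
  have hdeg : p.natDegree < n := by
    rw [Polynomial.natDegree_lt_iff_degree_lt hp0, ← Polynomial.mem_degreeLT]
    exact Submodule.sum_mem _ fun k _ => Polynomial.mem_degreeLT.2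
      ((Polynomial.degree_monomial_le _ _).trans_lt (by exact_mod_cast k.2))
  refine hdeg.not_ge (card_zeros_integral_eval_mul_exp_le (fun x => Real.exp_pos (-V x)) hW hp0 ha
    fun j => ?_)
  have hj := congrFun hMv j
  simp only [Matrix.mulVec, dotProduct, Matrix.of_apply, Pi.zero_apply] at hj
  rw [← hj]
  simp only [← integral_mul_const]
  rw [← integral_finsetSum _ fun k _ => (hpow _ _).mul_const _]
  congr with x
  rw [hexp, hp, Polynomial.eval_finsetSum, Finset.sum_mul]
  refine Finset.sum_congr rfl fun k _ => ?_
  rw [Polynomial.eval_monomial]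
  ring
end

section
/- Let a_1, …, a_p be distinct real numbers, let n_1, …, n_p ≥ 1 be integers with n = n_1 + ⋯ + n_p, and set w_i(x) = e^{−(V(x) − a_i x)} for i = 1, …, p. Let P be a monic polynomial of degree n such that ∫_ℝ P(x) x^j w_i(x) dx = 0 for all i = 1, …, p and all 0 ≤ j ≤ n_i − 1. Fix an index i₀ ∈ {1, …, p}, and suppose there exists exactly one monic polynomial R of degree n + 1 such that ∫_ℝ R(x) x^j w_i(x) dx = 0 for all i ≠ i₀ and 0 ≤ j ≤ n_i − 1, and ∫_ℝ R(x) x^j w_{i₀}(x) dx = 0 for 0 ≤ j ≤ n_{i₀}. Then ∫_ℝ P(x) x^{n_{i₀}} w_{i₀}(x) dx ≠ 0. -/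
open MeasureTheory

/-- If all absolute moments of a weight are finite, then every polynomial is integrable
against it. -/
theorem Polynomial.integrable_eval_mul_of_moments {g : ℝ → ℝ} (hg : AEStronglyMeasurable g)
    (hint : ∀ k : ℕ, Integrable (fun x : ℝ => |x| ^ k * g x)) (Q : Polynomial ℝ) :
    Integrable (fun x : ℝ => Q.eval x * g x) := by
  simp only [Polynomial.eval_eq_sum_range, Finset.sum_mul, mul_assoc]
  refine integrable_finsetSum _ fun k _ => Integrable.const_mul ?_ _
  refine (hint k).mono ?_ (.of_forall fun x => by simp)
  exact (continuous_pow k).aestronglyMeasurable.mul hg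

theorem statement_8 (V : ℝ → ℝ) (hV : Continuous V)
    (hVint : ∀ (a : ℝ) (k : ℕ),
      Integrable (fun x : ℝ => |x| ^ k * Real.exp (-(V x - a * x))))
    (p : ℕ) (a : Fin p → ℝ) (ha : Function.Injective a)
    (nm : Fin p → ℕ) (hnm : ∀ i, 1 ≤ nm i)
    (n : ℕ) (hn : n = ∑ i, nm i)
    (w : Fin p → ℝ → ℝ)
    (hw : ∀ (i : Fin p) (x : ℝ), w i x = Real.exp (-(V x - a i * x)))
    (P : Polynomial ℝ) (hPmonic : P.Monic) (hPdeg : P.natDegree = n)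
    (hPorth : ∀ (i : Fin p) (j : ℕ), j < nm i →
      ∫ x : ℝ, P.eval x * x ^ j * w i x = 0)
    (i₀ : Fin p)
    (hR : ∃! R : Polynomial ℝ, R.Monic ∧ R.natDegree = n + 1 ∧
      ∀ (i : Fin p) (j : ℕ), j < (if i = i₀ then nm i + 1 else nm i) →
        ∫ x : ℝ, R.eval x * x ^ j * w i x = 0) :
    (∫ x : ℝ, P.eval x * x ^ (nm i₀) * w i₀ x) ≠ 0 := by
  obtain ⟨R, ⟨hRmonic, hRdeg, hRorth⟩, hRuniq⟩ := hR
  have hwi : ∀ i, w i = fun x => Real.exp (-(V x - a i * x)) := fun i => funext (hw i)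
  have hint : ∀ (Q : Polynomial ℝ) (i : Fin p) (j : ℕ),
      Integrable (fun x : ℝ => Q.eval x * x ^ j * w i x) := fun Q i j => by
    have hcont : Continuous (w i) := by rw [hwi]; fun_prop
    have hmom : ∀ k : ℕ, Integrable (fun x : ℝ => |x| ^ k * w i x) := fun k => by
      rw [hwi]; exact hVint (a i) k
    refine (Polynomial.integrable_eval_mul_of_moments hcont.aestronglyMeasurable hmom
      (Q * Polynomial.X ^ j)).congr (.of_forall fun x => ?_)
    simp only [Polynomial.eval_mul, Polynomial.eval_pow, Polynomial.eval_X]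
  intro h
  have hdeg : P.degree < R.degree :=
    Polynomial.degree_lt_degree (by omega)
  have hsum : R + P = R := by
    refine hRuniq _ ⟨hRmonic.add_of_left hdeg, ?_, fun i j hj => ?_⟩
    · rw [Polynomial.natDegree_add_eq_left_of_degree_lt hdeg, hRdeg]
    · have hP : ∫ x : ℝ, P.eval x * x ^ j * w i x = 0 := by
        by_cases hlt : j < nm i
        · exact hPorth i j hlt
        · split_ifs at hj with hi
          · subst hi
            rwa [show j = nm i by omega]
          · exact absurd hj hlt
      simp only [Polynomial.eval_add, add_mul]
      rw [integral_add (hint R i j) (hint P i j), hRorth i j hj, hP, add_zero]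
  exact hPmonic.ne_zero (add_eq_left.mp hsum)
end

section
/- Let a_1, …, a_p be distinct real numbers with multiplicities n_1, …, n_p ≥ 1 and n = n_1 + ⋯ + n_p, and let α_1, …, α_n be an ordering of these eigenvalues in which a_i appears exactly n_i times. For 0 ≤ k ≤ n and 1 ≤ i ≤ p let k_i(k) be the number of indices m ≤ k with α_m = a_i. Suppose that for each 0 ≤ k ≤ n − 1, P_k is a monic polynomial of degree k with ∫_ℝ P_k(x) x^j e^{−(V(x) − a_i x)} dx = 0 for all i and all 0 ≤ j ≤ k_i(k) − 1, and that for each 1 ≤ k ≤ n, Q_{k−1} lies in the real linear span of { x^j e^{a_i x} : 1 ≤ i ≤ p, 0 ≤ j ≤ k_i(k) − 1 } and satisfies ∫_ℝ x^i Q_{k−1}(x) e^{−V(x)} dx = 0 for 0 ≤ i ≤ k − 2 and ∫_ℝ x^{k−1} Q_{k−1}(x) e^{−V(x)} dx = 1. Then for all 0 ≤ j, k ≤ n − 1, ∫_ℝ P_j(x) Q_k(x) e^{−V(x)} dx = δ_{jk} (equal to 1 if j = k and 0 otherwise). -/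
open MeasureTheory

/-- `countBelow ord i k` is the number of indices `m` with `m < k` (0-based, i.e. the
first `k` members `α_1, …, α_k` of the ordering) such that `α_m = a_i`. -/
def countBelow {n p : ℕ} (ord : Fin n → Fin p) (i : Fin p) (k : ℕ) : ℕ :=
  (Finset.univ.filter (fun m : Fin n => (m : ℕ) < k ∧ ord m = i)).card

theorem integrable_eval_mul_exp {W : ℝ → ℝ} (hW : Continuous W)
    (hint : ∀ k : ℕ, Integrable (fun x : ℝ => |x| ^ k * Real.exp (-(W x))))
    (R : Polynomial ℝ) :
    Integrable (fun x : ℝ => R.eval x * Real.exp (-(W x))) := by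
  have hmono (k : ℕ) : Integrable (fun x : ℝ => x ^ k * Real.exp (-(W x))) := by
    refine (hint k).mono' (by fun_prop) (Filter.Eventually.of_forall fun x => ?_)
    simp
  simp only [Polynomial.eval_eq_sum_range, Finset.sum_mul, mul_assoc]
  exact integrable_finsetSum _ fun i _ => (hmono i).const_mul _

theorem integrable_eval_mul_of_mem_span {V : ℝ → ℝ} {S : Set (ℝ → ℝ)} {f : ℝ → ℝ}
    {R : Polynomial ℝ} (hf : f ∈ Submodule.span ℝ S)
    (hS : ∀ g ∈ S, Integrable (fun x : ℝ => R.eval x * g x * Real.exp (-(V x)))) :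
    Integrable (fun x : ℝ => R.eval x * f x * Real.exp (-(V x))) := by
  induction hf using Submodule.span_induction with
  | mem g hg => exact hS g hg
  | zero => simp
  | add g h _ _ hg hh =>
    refine (hg.add hh).congr (Filter.Eventually.of_forall fun x => ?_)
    simp only [Pi.add_apply]
    ring
  | smul c g _ hg =>
    refine (hg.const_mul c).congr (Filter.Eventually.of_forall fun x => ?_)
    simp only [Pi.smul_apply, smul_eq_mul]
    ring

theorem integral_eval_mul_eq_zero_of_mem_span {V : ℝ → ℝ} {S : Set (ℝ → ℝ)} {f : ℝ → ℝ}
    {R : Polynomial ℝ} (hf : f ∈ Submodule.span ℝ S)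
    (hS : ∀ g ∈ S, Integrable (fun x : ℝ => R.eval x * g x * Real.exp (-(V x))))
    (hzero : ∀ g ∈ S, ∫ x : ℝ, R.eval x * g x * Real.exp (-(V x)) = 0) :
    ∫ x : ℝ, R.eval x * f x * Real.exp (-(V x)) = 0 := by
  induction hf using Submodule.span_induction with
  | mem g hg => exact hzero g hg
  | zero => simp
  | add g h hg_mem hh_mem hg hh =>
    simp only [Pi.add_apply, mul_add, add_mul]
    rw [integral_add (integrable_eval_mul_of_mem_span hg_mem hS)
      (integrable_eval_mul_of_mem_span hh_mem hS), hg, hh, add_zero]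
  | smul c g _ hg =>
    have heq (x : ℝ) : R.eval x * (c • g) x * Real.exp (-(V x)) =
        c * (R.eval x * g x * Real.exp (-(V x))) := by
      simp only [Pi.smul_apply, smul_eq_mul]
      ring
    simp only [heq]
    rw [integral_const_mul, hg, mul_zero]

theorem countBelow_mono {n p : ℕ} (ord : Fin n → Fin p) (i : Fin p) :
    Monotone (countBelow ord i) := by
  intro k l hkl
  refine Finset.card_le_card fun m hm => ?_
  simp only [Finset.mem_filter, Finset.mem_univ, true_and] at hm ⊢
  exact ⟨hm.1.trans_le hkl, hm.2⟩

theorem statement_10 (V : ℝ → ℝ) (hV : Continuous V)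
    (hVint : ∀ (a : ℝ) (k : ℕ),
      Integrable (fun x : ℝ => |x| ^ k * Real.exp (-(V x - a * x))))
    (p : ℕ) (a : Fin p → ℝ) (ha : Function.Injective a)
    (nm : Fin p → ℕ) (hnm : ∀ i, 1 ≤ nm i)
    (n : ℕ) (hn : n = ∑ i, nm i)
    -- the ordering `α_1, …, α_n`, in which `a_i` appears exactly `n_i` times
    (ord : Fin n → Fin p)
    (hord : ∀ i, (Finset.univ.filter (fun m : Fin n => ord m = i)).card = nm i)
    -- the monic polynomials `P_k`, `0 ≤ k ≤ n-1`
    (P : Fin n → Polynomial ℝ)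
    (hPmonic : ∀ k, (P k).Monic) (hPdeg : ∀ k, (P k).natDegree = (k : ℕ))
    (hPorth : ∀ (k : Fin n) (i : Fin p) (j : ℕ), j < countBelow ord i (k : ℕ) →
      ∫ x : ℝ, (P k).eval x * x ^ j * Real.exp (-(V x - a i * x)) = 0)
    -- the functions `Q_k`, `0 ≤ k ≤ n-1` (so `Q k` is `Q_{k'-1}` for `k' = k+1`)
    (Q : Fin n → ℝ → ℝ)
    (hQspan : ∀ k : Fin n, Q k ∈ Submodule.span ℝ
      {f : ℝ → ℝ | ∃ (i : Fin p) (j : ℕ), j < countBelow ord i ((k : ℕ) + 1) ∧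
        f = fun x => x ^ j * Real.exp (a i * x)})
    (hQorth : ∀ (k : Fin n) (i : ℕ), i < (k : ℕ) →
      ∫ x : ℝ, x ^ i * Q k x * Real.exp (-(V x)) = 0)
    (hQnorm : ∀ k : Fin n, ∫ x : ℝ, x ^ (k : ℕ) * Q k x * Real.exp (-(V x)) = 1) :
    ∀ j k : Fin n,
      ∫ x : ℝ, (P j).eval x * Q k x * Real.exp (-(V x)) =
        if j = k then 1 else 0 := by
  intro j k
  have hexp (b x : ℝ) : Real.exp (b * x) * Real.exp (-(V x)) = Real.exp (-(V x - b * x)) := by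
    rw [← Real.exp_add]
    ring_nf
  have hgen (R : Polynomial ℝ) (k : Fin n) : ∀ g ∈ {f : ℝ → ℝ | ∃ (i : Fin p) (j : ℕ),
      j < countBelow ord i ((k : ℕ) + 1) ∧ f = fun x => x ^ j * Real.exp (a i * x)},
      Integrable (fun x : ℝ => R.eval x * g x * Real.exp (-(V x))) := by
    rintro _ ⟨i, m, -, rfl⟩
    have h := integrable_eval_mul_exp (W := fun x => V x - a i * x) (by fun_prop)
      (hVint (a i)) (R * Polynomial.X ^ m)
    refine h.congr (Filter.Eventually.of_forall fun x => ?_)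
    simp only [Polynomial.eval_mul, Polynomial.eval_pow, Polynomial.eval_X, ← hexp]
    ring
  rcases lt_or_ge k j with hkj | hjk
  · rw [if_neg hkj.ne']
    refine integral_eval_mul_eq_zero_of_mem_span (hQspan k) (hgen (P j) k) ?_
    rintro _ ⟨i, m, hm, rfl⟩
    rw [← hPorth j i m (hm.trans_le (countBelow_mono ord i hkj))]
    congr 1 with x
    rw [← hexp]
    ring
  · have hint (m : ℕ) : Integrable (fun x : ℝ => x ^ m * Q k x * Real.exp (-(V x))) := by
      simpa using integrable_eval_mul_of_mem_span (hQspan k) (hgen (Polynomial.X ^ m) k)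
    simp only [Polynomial.eval_eq_sum_range, Finset.sum_mul, mul_assoc] at hint ⊢
    rw [integral_finsetSum _ fun i _ => (hint i).const_mul _]
    simp only [integral_const_mul]
    simp only [mul_assoc] at hQorth hQnorm
    rw [Finset.sum_range_succ, Finset.sum_eq_zero, zero_add, (hPmonic j).coeff_natDegree,
      one_mul, hPdeg]
    · split_ifs with h
      · rw [h, hQnorm]
      · exact hQorth k j (lt_of_le_of_ne hjk (Fin.val_ne_of_ne h))
    · intro i hi
      rw [Finset.mem_range, hPdeg] at hi
      rw [hQorth k i (hi.trans_le hjk), mul_zero]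
end

section
/- Let n ≥ 1 and let K : ℝ × ℝ → ℝ be a measurable function such that all the integrals below converge absolutely, ∫_ℝ K(y, y) dy = n, and ∫_ℝ K(x, y) K(y, z) dy = K(x, z) for all x, z ∈ ℝ. Then for every 1 ≤ m ≤ n and all λ_1, …, λ_m ∈ ℝ, (n!/(n−m)!) · ∫_{ℝ^{n−m}} (1/n!) det(K(λ_j, λ_k))_{1 ≤ j, k ≤ n} dλ_{m+1} ⋯ dλ_n = det(K(λ_j, λ_k))_{1 ≤ j, k ≤ m}. -/
open MeasureTheory

/-- Expansion of a determinant bordered by one row and one column. -/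
theorem Matrix.det_fromBlocks_bordered {ι R : Type*} [Fintype ι] [DecidableEq ι] [CommRing R]
    (A : Matrix ι ι R) (B : Matrix ι (Fin 1) R) (C : Matrix (Fin 1) ι R)
    (D : Matrix (Fin 1) (Fin 1) R) :
    (Matrix.fromBlocks A B C D).det =
      D 0 0 * A.det - ∑ j, ∑ i, A.adjugate j i * (B i 0 * C 0 j) := by
  have hadj (j : ι ⊕ Fin 1) : (Matrix.fromBlocks A B C D).adjugate j (Sum.inr 0) =
      ((Matrix.fromBlocks A B C D).updateCol j (Pi.single (Sum.inr 0) 1)).det := by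
    rw [← Matrix.cramer_apply, Matrix.cramer_eq_adjugate_mulVec, Matrix.mulVec_single_one,
      Matrix.col_apply]
  have hinr : (Matrix.fromBlocks A B C D).adjugate (Sum.inr 0) (Sum.inr 0) = A.det := by
    have : (Matrix.fromBlocks A B C D).updateCol (Sum.inr 0) (Pi.single (Sum.inr 0) 1) =
        Matrix.fromBlocks A 0 C 1 := by
      ext (i | i) (j | j) <;> simp [Subsingleton.elim _ (0 : Fin 1)]
    rw [hadj, this, Matrix.det_fromBlocks_zero₁₂, Matrix.det_one, mul_one]
  have hinl (j : ι) : (Matrix.fromBlocks A B C D).adjugate (Sum.inl j) (Sum.inr 0) =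
      -∑ i, A.adjugate j i * B i 0 := by
    have : ((Matrix.fromBlocks A B C D).updateCol (Sum.inl j) (Pi.single (Sum.inr 0) 1)).submatrix
        id (Equiv.swap (Sum.inl j) (Sum.inr 0)) =
        Matrix.fromBlocks (A.updateCol j fun i => B i 0) 0
          (C.updateCol j fun _ => D 0 0) 1 := by
      ext (i | i) (k | k)
      · by_cases h : k = j
        · subst h; simp
        · rw [Matrix.submatrix_apply, Equiv.swap_apply_of_ne_of_ne (by simpa) (by simp)]
          simp [h]
      · simp [Subsingleton.elim _ (0 : Fin 1)]
      · by_cases h : k = j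
        · subst h; simp [Subsingleton.elim _ (0 : Fin 1)]
        · rw [Matrix.submatrix_apply, Equiv.swap_apply_of_ne_of_ne (by simpa) (by simp)]
          simp [h]
      · simp [Subsingleton.elim _ (0 : Fin 1)]
    have hswap := congrArg Matrix.det this
    rw [Matrix.det_permute', Equiv.Perm.sign_swap (by simp), Matrix.det_fromBlocks_zero₁₂,
      Matrix.det_one, mul_one, ← hadj, ← Matrix.cramer_apply,
      Matrix.cramer_eq_adjugate_mulVec] at hswap
    simpa [Matrix.mulVec, dotProduct] using congrArg Neg.neg hswap
  rw [Matrix.det_eq_sum_mul_adjugate_row _ (Sum.inr 0)]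
  simp only [Fintype.sum_sum_type, Finset.univ_unique, Finset.sum_singleton, Fin.default_eq_zero,
    Matrix.fromBlocks_apply₂₁, Matrix.fromBlocks_apply₂₂, hinl, hinr]
  simp only [mul_neg, Finset.sum_neg_distrib, Finset.mul_sum]
  rw [add_comm, ← sub_eq_add_neg]
  simp only [mul_left_comm, mul_comm]

/-- Adding one point `y` to the determinant of a kernel on the points `x`. -/
theorem det_kernel_snoc {R S : Type*} [CommRing R] {N : ℕ} (K : S → S → R) (x : Fin N → S)
    (y : S) :
    (Matrix.of fun i j : Fin (N + 1) =>
        K (Fin.snoc (α := fun _ => S) x y i) (Fin.snoc (α := fun _ => S) x y j)).det =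
      K y y * (Matrix.of fun i j => K (x i) (x j)).det -
        ∑ j, ∑ i, (Matrix.of fun i j => K (x i) (x j)).adjugate j i * (K (x i) y * K y (x j)) := by
  have h : (Matrix.of fun i j : Fin (N + 1) =>
        K (Fin.snoc (α := fun _ => S) x y i) (Fin.snoc (α := fun _ => S) x y j)).submatrix
        finSumFinEquiv finSumFinEquiv =
      Matrix.fromBlocks (Matrix.of fun i j => K (x i) (x j)) (Matrix.of fun i _ => K (x i) y)
        (Matrix.of fun _ j => K y (x j)) (Matrix.of fun _ _ => K y y) := by
    have hl (i : Fin N) : Fin.snoc (α := fun _ => S) x y (Fin.castAdd 1 i) = x i :=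
      Fin.snoc_castSucc (α := fun _ => S) ..
    have hr (i : Fin 1) : Fin.snoc (α := fun _ => S) x y (Fin.natAdd N i) = y := by
      rw [Subsingleton.elim i 0]
      exact Fin.snoc_last (α := fun _ => S) ..
    ext (i | i) (j | j) <;> simp [hl, hr]
  rw [← Matrix.det_submatrix_equiv_self finSumFinEquiv, h, Matrix.det_fromBlocks_bordered]
  rfl

section ReproducingKernel

variable {S : Type*} [MeasurableSpace S] {μ : Measure S} {K : S → S → ℝ}

/-- Integrating out one variable of the determinant of a reproducing kernel. -/
theorem integral_det_kernel_snoc (htraceInt : Integrable (fun y => K y y) μ)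
    (hreproInt : ∀ x z, Integrable (fun y => K x y * K y z) μ)
    (hrepro : ∀ x z, ∫ y, K x y * K y z ∂μ = K x z) {N : ℕ} (x : Fin N → S) :
    ∫ y, (Matrix.of fun i j : Fin (N + 1) =>
        K (Fin.snoc (α := fun _ => S) x y i) (Fin.snoc (α := fun _ => S) x y j)).det ∂μ =
      ((∫ y, K y y ∂μ) - N) * (Matrix.of fun i j => K (x i) (x j)).det := by
  set A : Matrix (Fin N) (Fin N) ℝ := Matrix.of fun i j => K (x i) (x j) with hA
  have hadj : ∑ j, ∑ i, A.adjugate j i * K (x i) (x j) = N * A.det := by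
    have h := congrArg Matrix.trace A.adjugate_mul
    simpa [Matrix.trace, Matrix.mul_apply, hA, mul_comm] using h
  simp only [det_kernel_snoc, ← hA]
  have hint (j i : Fin N) : Integrable (fun y => A.adjugate j i * (K (x i) y * K y (x j))) μ :=
    (hreproInt _ _).const_mul _
  rw [integral_sub (htraceInt.mul_const _)
    (integrable_finsetSum _ fun j _ => integrable_finsetSum _ fun i _ => hint j i),
    integral_mul_const, integral_finsetSum _ fun j _ => integrable_finsetSum _ fun i _ => hint j i]
  simp_rw [integral_finsetSum _ fun i _ => hint _ i, integral_const_mul, hrepro, hadj]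
  ring

/-- Integrating out `k` variables of the determinant of a reproducing kernel. -/
theorem integral_det_kernel_append [SigmaFinite μ] (htraceInt : Integrable (fun y => K y y) μ)
    (hreproInt : ∀ x z, Integrable (fun y => K x y * K y z) μ)
    (hrepro : ∀ x z, ∫ y, K x y * K y z ∂μ = K x z) {m : ℕ} (l : Fin m → S) (k : ℕ)
    (hdetInt : Integrable (fun u : Fin k → S => (Matrix.of fun i j : Fin (m + k) =>
      K (Fin.append l u i) (Fin.append l u j)).det) (Measure.pi fun _ => μ)) :
    ∫ u : Fin k → S, (Matrix.of fun i j : Fin (m + k) =>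
        K (Fin.append l u i) (Fin.append l u j)).det ∂(Measure.pi fun _ => μ) =
      (∏ i ∈ Finset.range k, ((∫ y, K y y ∂μ) - (m + i : ℕ))) *
        (Matrix.of fun i j => K (l i) (l j)).det := by
  induction k with
  | zero =>
    have h (u : Fin 0 → S) : Fin.append l u = l := by
      rw [Subsingleton.elim u Fin.elim0, Fin.append_elim0]; rfl
    simp only [h]
    simp [measureReal_def]
  | succ k ih =>
    have hmp := (measurePreserving_piFinSuccAbove (fun _ : Fin (k + 1) => μ) (Fin.last k)).symm
    have hsymm (q : S × (Fin k → S)) :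
        (MeasurableEquiv.piFinSuccAbove (fun _ : Fin (k + 1) => S) (Fin.last k)).symm q =
          Fin.snoc q.2 q.1 := by
      simp [MeasurableEquiv.piFinSuccAbove, Fin.snocEquiv]
    have hF (q : S × (Fin k → S)) :
        (Matrix.of fun i j : Fin (m + (k + 1)) =>
          K (Fin.append l (Fin.snoc q.2 q.1) i) (Fin.append l (Fin.snoc q.2 q.1) j)).det =
        (Matrix.of fun i j : Fin (m + k + 1) =>
          K (Fin.snoc (α := fun _ => S) (Fin.append l q.2) q.1 i)
            (Fin.snoc (α := fun _ => S) (Fin.append l q.2) q.1 j)).det := by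
      rw [Fin.append_snoc]; rfl
    rw [← hmp.integrable_comp_emb (MeasurableEquiv.measurableEmbedding _)] at hdetInt
    rw [← hmp.integral_comp']
    simp only [Function.comp_def, hsymm, hF] at hdetInt ⊢
    have hstep := hdetInt.integral_prod_right
    rw [integral_prod_symm _ hdetInt]
    simp only [integral_det_kernel_snoc htraceInt hreproInt hrepro] at hstep ⊢
    rw [integral_const_mul, Finset.prod_range_succ]
    by_cases hc : (∫ y, K y y ∂μ) - (m + k : ℕ) = 0
    · rw [hc]; simp
    · rw [ih ((integrable_const_mul_iff (IsUnit.mk0 _ hc) _).1 hstep)]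
      ring

end ReproducingKernel

/-- STATEMENT 13, with `n = m + k`, so that the `k` variables `λ_{m+1}, …, λ_n`
are the ones being integrated out. -/
theorem statement_13 (m k : ℕ) (hm : 1 ≤ m)
    (K : ℝ → ℝ → ℝ) (hKmeas : Measurable fun q : ℝ × ℝ => K q.1 q.2)
    (htraceInt : Integrable (fun y : ℝ => K y y))
    (htrace : (∫ y : ℝ, K y y) = (m + k : ℕ))
    (hreproInt : ∀ x z : ℝ, Integrable (fun y : ℝ => K x y * K y z))
    (hrepro : ∀ x z : ℝ, (∫ y : ℝ, K x y * K y z) = K x z)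
    (l : Fin m → ℝ)
    (hdetInt : Integrable (fun u : Fin k → ℝ =>
      Matrix.det (Matrix.of (fun i j : Fin (m + k) =>
        K (Fin.append l u i) (Fin.append l u j))))) :
    ((Nat.factorial (m + k) : ℝ) / (Nat.factorial k : ℝ)) *
      ∫ u : Fin k → ℝ,
        (1 / (Nat.factorial (m + k) : ℝ)) *
          Matrix.det (Matrix.of (fun i j : Fin (m + k) =>
            K (Fin.append l u i) (Fin.append l u j))) =
    Matrix.det (Matrix.of (fun i j : Fin m => K (l i) (l j))) := by
  have h := integral_det_kernel_append htraceInt hreproInt hrepro l k hdetInt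
  have hprod : ∏ i ∈ Finset.range k, (((m + k : ℕ) : ℝ) - (m + i : ℕ)) = (k.factorial : ℝ) := by
    rw [← Finset.prod_range_add_one_eq_factorial, ← Finset.prod_range_reflect]
    push_cast
    refine Finset.prod_congr rfl fun i hi => ?_
    rw [Finset.mem_range] at hi
    rw [Nat.cast_sub (by omega), Nat.cast_sub (by omega)]
    push_cast
    ring
  rw [htrace, hprod] at h
  rw [integral_const_mul, volume_pi, h]
  have := Nat.factorial_ne_zero k
  have := Nat.factorial_ne_zero (m + k)
  field_simp
end

section
/- Let n_1, n_2 ≥ 0 and suppose the type I multiple orthogonal functions Q_{n_1,n_2+1}, Q_{n_1+1,n_2}, Q_{n_1+1,n_2+1} exist, the type II multiple orthogonal polynomials P_{n_1,n_2}, P_{n_1,n_2+1}, P_{n_1+1,n_2} exist, and every function of the form A(x) e^{a_1 x} + B(x) e^{a_2 x}, with A a polynomial of degree at most n_1 and B of degree at most n_2, satisfying ∫ x^j (A(x) e^{a_1 x} + B(x) e^{a_2 x}) e^{−V(x)} dx = 0 for all 0 ≤ j ≤ n_1 + n_2, is a scalar multiple of Q_{n_1+1,n_2+1}. Then there exists β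 ∈ ℝ with Q_{n_1,n_2+1} − Q_{n_1+1,n_2} = β · Q_{n_1+1,n_2+1}, and this β satisfies β · h^{(1)}_{n_1,n_2} = −h^{(1)}_{n_1,n_2+1} and β · h^{(2)}_{n_1,n_2} = h^{(2)}_{n_1+1,n_2}. -/
open MeasureTheory

/-- The weight `w(x) = e^{-(V(x) - a x)}`. -/
noncomputable def wgt (V : ℝ → ℝ) (a x : ℝ) : ℝ := Real.exp (-(V x - a * x))

/-- The function `A(x) e^{a₁ x} + B(x) e^{a₂ x}` built from two polynomials. -/
noncomputable def typeIFun (a₁ a₂ : ℝ) (A B : Polynomial ℝ) (x : ℝ) : ℝ :=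
  Polynomial.eval x A * Real.exp (a₁ * x) + Polynomial.eval x B * Real.exp (a₂ * x)

/-- `P` is the type II multiple orthogonal polynomial `P_{k₁,k₂}`: monic of degree
`k₁ + k₂`, with `kⱼ` orthogonality conditions with respect to `wⱼ`, `j = 1, 2`. -/
structure IsTypeII (V : ℝ → ℝ) (a₁ a₂ : ℝ) (k₁ k₂ : ℕ) (P : Polynomial ℝ) : Prop where
  monic : P.Monic
  natDeg : P.natDegree = k₁ + k₂
  orth₁ : ∀ i : ℕ, i < k₁ → (∫ x : ℝ, Polynomial.eval x P * x ^ i * wgt V a₁ x) = 0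
  orth₂ : ∀ i : ℕ, i < k₂ → (∫ x : ℝ, Polynomial.eval x P * x ^ i * wgt V a₂ x) = 0

/-- `(A, B)` gives the type I multiple orthogonal function
`Q_{k₁,k₂}(x) = A(x) e^{a₁ x} + B(x) e^{a₂ x}`, where `deg A ≤ k₁ - 1`,
`deg B ≤ k₂ - 1`, `∫ x^j Q(x) e^{-V(x)} dx = 0` for `j = 0, …, k₁ + k₂ - 2`
and `= 1` for `j = k₁ + k₂ - 1`. -/
structure IsTypeI (V : ℝ → ℝ) (a₁ a₂ : ℝ) (k₁ k₂ : ℕ) (A B : Polynomial ℝ) : Prop where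
  degA : A.degree < (k₁ : WithBot ℕ)
  degB : B.degree < (k₂ : WithBot ℕ)
  orth : ∀ j : ℕ, j + 1 < k₁ + k₂ →
    (∫ x : ℝ, x ^ j * typeIFun a₁ a₂ A B x * Real.exp (-(V x))) = 0
  norm : (∫ x : ℝ, x ^ (k₁ + k₂ - 1) * typeIFun a₁ a₂ A B x * Real.exp (-(V x))) = 1

/-- The number `h^{(j)}_{k₁,k₂} = ∫ P_{k₁,k₂}(x) x^{k_j} w_j(x) dx`; here `a = a_j`
and `k = k_j`, and `P` should be the polynomial `P_{k₁,k₂}`. -/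
noncomputable def hNum (V : ℝ → ℝ) (a : ℝ) (k : ℕ) (P : Polynomial ℝ) : ℝ :=
  ∫ x : ℝ, Polynomial.eval x P * x ^ k * wgt V a x

open Polynomial in
/-- The moment functional `p ↦ ∫ p(x) w(x) dx` of a weight with finite moments. -/
noncomputable def momentFunctional (w : ℝ → ℝ)
    (hw : ∀ p : ℝ[X], Integrable (fun x => p.eval x * w x)) : ℝ[X] →ₗ[ℝ] ℝ where
  toFun p := ∫ x, p.eval x * w x
  map_add' p q := by
    simp only [eval_add, add_mul]
    exact integral_add (hw p) (hw q)
  map_smul' c p := by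
    simp only [eval_smul, smul_eq_mul, mul_assoc, RingHom.id_apply]
    exact integral_const_mul c _

open Polynomial in
theorem integrable_eval_mul_wgt {V : ℝ → ℝ} (hV : Continuous V)
    (hVint : ∀ (a : ℝ) (k : ℕ), Integrable (fun x : ℝ => |x| ^ k * Real.exp (-(V x - a * x))))
    (a : ℝ) (p : ℝ[X]) : Integrable (fun x => p.eval x * wgt V a x) := by
  have hmono (k : ℕ) : Integrable (fun x : ℝ => x ^ k * wgt V a x) := by
    refine (hVint a k).mono' ?_ (ae_of_all _ fun x => ?_)
    · unfold wgt
      exact Continuous.aestronglyMeasurable (by fun_prop)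
    · simp [wgt]
  simp only [eval_eq_sum_range, Finset.sum_mul, mul_assoc]
  exact integrable_finsetSum _ fun k _ => (hmono k).const_mul _

open Polynomial in
/-- If `L` annihilates `P, P X, …, P X^(k-1)`, then `L (P A)` only sees the coefficient of `X^k`
in a polynomial `A` of degree at most `k`. -/
theorem map_mul_eq_coeff_mul (L : ℝ[X] →ₗ[ℝ] ℝ) {P A : ℝ[X]} {k : ℕ}
    (hP : ∀ i < k, L (P * X ^ i) = 0) (hA : A.degree < ((k + 1 : ℕ) : WithBot ℕ)) :
    L (P * A) = A.coeff k * L (P * X ^ k) := by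
  have hA' : A.natDegree < k + 1 := by
    rcases eq_or_ne A 0 with rfl | h0
    · simp
    · exact (natDegree_lt_iff_degree_lt h0).2 hA
  have h (i : ℕ) : L (P * (C (A.coeff i) * X ^ i)) = A.coeff i * L (P * X ^ i) := by
    rw [mul_left_comm, ← smul_eq_C_mul, map_smul, smul_eq_mul]
  conv_lhs => rw [A.as_sum_range_C_mul_X_pow' hA']
  rw [Finset.sum_range_succ, mul_add, map_add, h, Finset.mul_sum, map_sum,
    Finset.sum_eq_zero fun i hi => by rw [h, hP i (Finset.mem_range.1 hi), mul_zero], zero_add]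

theorem typeIFun_mul_exp (V : ℝ → ℝ) (a₁ a₂ : ℝ) (A B : Polynomial ℝ) (x : ℝ) :
    typeIFun a₁ a₂ A B x * Real.exp (-(V x)) =
      A.eval x * wgt V a₁ x + B.eval x * wgt V a₂ x := by
  have h (a : ℝ) : wgt V a x = Real.exp (a * x) * Real.exp (-(V x)) := by
    rw [wgt, ← Real.exp_add]
    ring_nf
  rw [h, h, typeIFun]
  ring

theorem typeIFun_comm (a₁ a₂ : ℝ) (A B : Polynomial ℝ) :
    typeIFun a₁ a₂ A B = typeIFun a₂ a₁ B A :=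
  funext fun _ => add_comm _ _

theorem typeIFun_sub (a₁ a₂ : ℝ) (A B A' B' : Polynomial ℝ) (x : ℝ) :
    typeIFun a₁ a₂ (A - A') (B - B') x = typeIFun a₁ a₂ A B x - typeIFun a₁ a₂ A' B' x := by
  simp only [typeIFun, Polynomial.eval_sub]
  ring

theorem IsTypeI.swap {V : ℝ → ℝ} {a₁ a₂ : ℝ} {k₁ k₂ : ℕ} {A B : Polynomial ℝ}
    (h : IsTypeI V a₁ a₂ k₁ k₂ A B) : IsTypeI V a₂ a₁ k₂ k₁ B A where
  degA := h.degB
  degB := h.degA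
  orth := by simpa only [typeIFun_comm a₁, add_comm k₁] using h.orth
  norm := by simpa only [typeIFun_comm a₁, add_comm k₁] using h.norm

theorem IsTypeII.swap {V : ℝ → ℝ} {a₁ a₂ : ℝ} {k₁ k₂ : ℕ} {P : Polynomial ℝ}
    (h : IsTypeII V a₁ a₂ k₁ k₂ P) : IsTypeII V a₂ a₁ k₂ k₁ P where
  monic := h.monic
  natDeg := h.natDeg.trans (add_comm _ _)
  orth₁ := h.orth₂
  orth₂ := h.orth₁

theorem integrable_pow_mul_typeIFun {V : ℝ → ℝ}
    (hw : ∀ (a : ℝ) (p : Polynomial ℝ), Integrable (fun x => p.eval x * wgt V a x))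
    (a₁ a₂ : ℝ) (A B : Polynomial ℝ) (j : ℕ) :
    Integrable (fun x : ℝ => x ^ j * typeIFun a₁ a₂ A B x * Real.exp (-(V x))) := by
  refine ((hw a₁ (.X ^ j * A)).add (hw a₂ (.X ^ j * B))).congr (ae_of_all _ fun x => ?_)
  simp only [mul_assoc, typeIFun_mul_exp, Polynomial.eval_mul, Polynomial.eval_pow,
    Polynomial.eval_X, Pi.add_apply]
  ring

theorem integral_pow_mul_typeIFun {V : ℝ → ℝ}
    (hw : ∀ (a : ℝ) (p : Polynomial ℝ), Integrable (fun x => p.eval x * wgt V a x))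
    (a₁ a₂ : ℝ) (A B : Polynomial ℝ) (j : ℕ) :
    (∫ x : ℝ, x ^ j * typeIFun a₁ a₂ A B x * Real.exp (-(V x))) =
      momentFunctional _ (hw a₁) (A * .X ^ j) + momentFunctional _ (hw a₂) (B * .X ^ j) := by
  refine Eq.trans ?_ (integral_add (hw a₁ _) (hw a₂ _))
  refine integral_congr_ae (ae_of_all _ fun x => ?_)
  simp only [mul_assoc, typeIFun_mul_exp, Polynomial.eval_mul, Polynomial.eval_pow,
    Polynomial.eval_X]
  ring

/-- Pairing the type II polynomial `P_{k₁,k₂}` with the type I function `Q_{k₁+1,k₂}` shows that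
the leading coefficient of the latter is the inverse of `h^{(1)}_{k₁,k₂}`. -/
theorem IsTypeI.coeff_mul_hNum {V : ℝ → ℝ}
    (hw : ∀ (a : ℝ) (p : Polynomial ℝ), Integrable (fun x => p.eval x * wgt V a x))
    {a₁ a₂ : ℝ} {k₁ k₂ : ℕ} {A B P : Polynomial ℝ}
    (hQ : IsTypeI V a₁ a₂ (k₁ + 1) k₂ A B) (hP : IsTypeII V a₁ a₂ k₁ k₂ P) :
    A.coeff k₁ * hNum V a₁ k₁ P = 1 := by
  have hL (a : ℝ) (i : ℕ) : momentFunctional _ (hw a) (P * .X ^ i) =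
      ∫ x : ℝ, Polynomial.eval x P * x ^ i * wgt V a x := by
    simp [momentFunctional]
  set L₁ := momentFunctional _ (hw a₁)
  set L₂ := momentFunctional _ (hw a₂)
  let M : Polynomial ℝ →ₗ[ℝ] ℝ := L₁ ∘ₗ LinearMap.mulLeft ℝ A + L₂ ∘ₗ LinearMap.mulLeft ℝ B
  have hM (p : Polynomial ℝ) : M p = L₁ (A * p) + L₂ (B * p) := rfl
  have horth (i : ℕ) (hi : i < k₁ + k₂) : M (1 * .X ^ i) = 0 := by
    rw [one_mul, hM, ← integral_pow_mul_typeIFun hw]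
    exact hQ.orth i (by omega)
  have hnorm : M (1 * .X ^ (k₁ + k₂)) = 1 := by
    rw [one_mul, hM, ← integral_pow_mul_typeIFun hw, ← hQ.norm,
      show k₁ + 1 + k₂ - 1 = k₁ + k₂ by omega]
  have hdeg : P.degree < ((k₁ + k₂ + 1 : ℕ) : WithBot ℕ) :=
    Polynomial.degree_le_natDegree.trans_lt
      (by rw [hP.natDeg]; exact_mod_cast Nat.lt_succ_self _)
  have hMP : M P = 1 := by
    have h := map_mul_eq_coeff_mul M horth hdeg
    rwa [one_mul, hnorm, mul_one, ← hP.natDeg, hP.monic.coeff_natDegree] at h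
  have hL₁ : L₁ (P * A) = A.coeff k₁ * hNum V a₁ k₁ P := by
    rw [map_mul_eq_coeff_mul L₁ (fun i hi => (hL a₁ i).trans (hP.orth₁ i hi)) hQ.degA, hL, hNum]
  have hL₂ : L₂ (P * B) = 0 := by
    rw [map_mul_eq_coeff_mul L₂ (fun i hi => (hL a₂ i).trans (hP.orth₂ i hi))
      (hQ.degB.trans (by exact_mod_cast Nat.lt_succ_self _)),
      Polynomial.coeff_eq_zero_of_degree_lt hQ.degB, zero_mul]
  rw [← hL₁, ← hMP, hM, mul_comm A, mul_comm B, hL₂, add_zero]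

theorem statement_16 (V : ℝ → ℝ) (hV : Continuous V)
    (hVint : ∀ (a : ℝ) (k : ℕ),
      Integrable (fun x : ℝ => |x| ^ k * Real.exp (-(V x - a * x))))
    (a₁ a₂ : ℝ) (ha : a₁ ≠ a₂)
    (n₁ n₂ : ℕ)
    -- the type I functions `Q_{n₁,n₂+1}`, `Q_{n₁+1,n₂}`, `Q_{n₁+1,n₂+1}`
    (A₁₂ B₁₂ : Polynomial ℝ) (hQ₁₂ : IsTypeI V a₁ a₂ n₁ (n₂ + 1) A₁₂ B₁₂)
    (A₂₁ B₂₁ : Polynomial ℝ) (hQ₂₁ : IsTypeI V a₁ a₂ (n₁ + 1) n₂ A₂₁ B₂₁)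
    (A₂₂ B₂₂ : Polynomial ℝ) (hQ₂₂ : IsTypeI V a₁ a₂ (n₁ + 1) (n₂ + 1) A₂₂ B₂₂)
    -- the type II polynomials `P_{n₁,n₂}`, `P_{n₁,n₂+1}`, `P_{n₁+1,n₂}`
    (P₁₁ : Polynomial ℝ) (hP₁₁ : IsTypeII V a₁ a₂ n₁ n₂ P₁₁)
    (P₁₂ : Polynomial ℝ) (hP₁₂ : IsTypeII V a₁ a₂ n₁ (n₂ + 1) P₁₂)
    (P₂₁ : Polynomial ℝ) (hP₂₁ : IsTypeII V a₁ a₂ (n₁ + 1) n₂ P₂₁)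
    -- every function `A(x)e^{a₁x} + B(x)e^{a₂x}` with `deg A ≤ n₁`, `deg B ≤ n₂`
    -- satisfying the `n₁+n₂+1` orthogonality conditions is a multiple of `Q_{n₁+1,n₂+1}`
    (huniq : ∀ A B : Polynomial ℝ, A.degree < ((n₁ + 1 : ℕ) : WithBot ℕ) →
      B.degree < ((n₂ + 1 : ℕ) : WithBot ℕ) →
      (∀ j : ℕ, j ≤ n₁ + n₂ →
        (∫ x : ℝ, x ^ j * typeIFun a₁ a₂ A B x * Real.exp (-(V x))) = 0) →
      ∃ c : ℝ, A = c • A₂₂ ∧ B = c • B₂₂) :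
    ∃ β : ℝ,
      (∀ x : ℝ, typeIFun a₁ a₂ A₁₂ B₁₂ x - typeIFun a₁ a₂ A₂₁ B₂₁ x =
        β * typeIFun a₁ a₂ A₂₂ B₂₂ x) ∧
      β * hNum V a₁ n₁ P₁₁ = -hNum V a₁ n₁ P₁₂ ∧
      β * hNum V a₂ n₂ P₁₁ = hNum V a₂ n₂ P₂₁ := by
  have hw := integrable_eval_mul_wgt hV hVint
  have hlt (n : ℕ) : ((n : ℕ) : WithBot ℕ) < ((n + 1 : ℕ) : WithBot ℕ) := by
    exact_mod_cast Nat.lt_succ_self n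
  obtain ⟨β, hA, hB⟩ := huniq (A₁₂ - A₂₁) (B₁₂ - B₂₁)
    ((Polynomial.degree_sub_le _ _).trans_lt (max_lt (hQ₁₂.degA.trans (hlt _)) hQ₂₁.degA))
    ((Polynomial.degree_sub_le _ _).trans_lt (max_lt hQ₁₂.degB (hQ₂₁.degB.trans (hlt _))))
    (fun j hj => by
      simp only [typeIFun_sub, mul_sub, sub_mul]
      rw [integral_sub (integrable_pow_mul_typeIFun hw _ _ _ _ _)
        (integrable_pow_mul_typeIFun hw _ _ _ _ _), sub_eq_zero]
      rcases hj.lt_or_eq with hj | rfl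
      · rw [hQ₁₂.orth j (by omega), hQ₂₁.orth j (by omega)]
      · have h₁₂ := hQ₁₂.norm
        have h₂₁ := hQ₂₁.norm
        rw [show n₁ + (n₂ + 1) - 1 = n₁ + n₂ by omega] at h₁₂
        rw [show n₁ + 1 + n₂ - 1 = n₁ + n₂ by omega] at h₂₁
        rw [h₁₂, h₂₁])
  have hcA : -A₂₁.coeff n₁ = β * A₂₂.coeff n₁ := by
    simpa [Polynomial.coeff_eq_zero_of_degree_lt hQ₁₂.degA] using
      congrArg (Polynomial.coeff · n₁) hA
  have hcB : B₁₂.coeff n₂ = β * B₂₂.coeff n₂ := by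
    simpa [Polynomial.coeff_eq_zero_of_degree_lt hQ₂₁.degB] using
      congrArg (Polynomial.coeff · n₂) hB
  have hA₂₁ := hQ₂₁.coeff_mul_hNum hw hP₁₁
  have hA₂₂ := hQ₂₂.coeff_mul_hNum hw hP₁₂
  have hB₁₂ := hQ₁₂.swap.coeff_mul_hNum hw hP₁₁.swap
  have hB₂₂ := hQ₂₂.swap.coeff_mul_hNum hw hP₂₁.swap
  refine ⟨β, fun x => ?_, ?_, ?_⟩
  · rw [← typeIFun_sub, hA, hB]
    simp only [typeIFun, Polynomial.eval_smul, smul_eq_mul]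
    ring
  · linear_combination (-(β * hNum V a₁ n₁ P₁₁)) * hA₂₂ - hNum V a₁ n₁ P₁₁ * hNum V a₁ n₁ P₁₂ * hcA
      - hNum V a₁ n₁ P₁₂ * hA₂₁
  · linear_combination (-(β * hNum V a₂ n₂ P₁₁)) * hB₂₂ - hNum V a₂ n₂ P₁₁ * hNum V a₂ n₂ P₂₁ * hcB
      + hNum V a₂ n₂ P₂₁ * hB₁₂
end
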